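/- Let c:A be a sound approximation of dynamic policy D. If ⊢{c}Γ is derived by the dependency type system and the equivalence relation ≡_{Γ(a_p)} is coarser than A(a_p) for all channel–program-point pairs a_p, then c is PI secure for D against all forgetful attackers on all channels and for all initial stores. -/

import Mathlib

/-- Program variables. -/
abbrev PVar := String
/-- Channels. -/
abbrev Chan := String
/-- Program points. -/
abbrev PPoint := String
/-- Values. -/
abbrev Val := ℤ
/-- Stores map program variables to values. -/
abbrev Store := PVar → Val

/-- Expressions: integer constants or variables. -/
inductive Expr where
  | const : Val → Expr
  | var : PVar → Expr
deriving DecidableEq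

def Expr.eval : Expr → Store → Val
  | .const v, _ => v
  | .var x, σ => σ x

def Expr.fv : Expr → Set PVar
  | .const _ => ∅
  | .var x => {x}

/-- Commands of the while-language with annotated outputs. -/
inductive Cmd where
  | skip : Cmd
  | seq : Cmd → Cmd → Cmd
  | assign : PVar → Expr → Cmd
  | ite : Expr → Cmd → Cmd → Cmd
  | while : Expr → Cmd → Cmd
  | out : Expr → Chan → PPoint → Cmd
deriving DecidableEq

/-- Step labels: silent, or an output (channel, value, program point). -/
inductive Label where
  | silent : Label
  | out : Chan → Val → PPoint → Label
deriving DecidableEq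

abbrev Config := Cmd × Store

/-- Small-step semantics. -/
inductive Step : Config → Label → Config → Prop where
  | skipSeq : ∀ (c : Cmd) (σ : Store), Step (.seq .skip c, σ) .silent (c, σ)
  | seq : ∀ {c₁ : Cmd} {σ : Store} {α : Label} {c₁' : Cmd} {σ' : Store} (c₂ : Cmd),
      Step (c₁, σ) α (c₁', σ') → Step (.seq c₁ c₂, σ) α (.seq c₁' c₂, σ')
  | assign : ∀ (x : PVar) (e : Expr) (σ : Store),
      Step (.assign x e, σ) .silent (.skip, Function.update σ x (e.eval σ))
  | out : ∀ (e : Expr) (a : Chan) (p : PPoint) (σ : Store),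
      Step (.out e a p, σ) (.out a (e.eval σ) p) (.skip, σ)
  | whileStep : ∀ (e : Expr) (c : Cmd) (σ : Store),
      Step (.while e c, σ) .silent (.ite e (.seq c (.while e c)) .skip, σ)
  | iteTrue : ∀ {e : Expr} {σ : Store} (c₁ c₂ : Cmd),
      e.eval σ ≠ 0 → Step (.ite e c₁ c₂, σ) .silent (c₁, σ)
  | iteFalse : ∀ {e : Expr} {σ : Store} (c₁ c₂ : Cmd),
      e.eval σ = 0 → Step (.ite e c₁ c₂, σ) .silent (c₂, σ)

/-- Prepend a label to a list of (output) labels, dropping silent labels. -/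
def Label.consTo : Label → List Label → List Label
  | .silent, ls => ls
  | l, ls => l :: ls

/-- `Steps cfg ls n cfg'`: `n` evaluation steps from `cfg` to `cfg'`, producing
the list `ls` of output labels (silent steps contribute nothing). -/
inductive Steps : Config → List Label → ℕ → Config → Prop where
  | refl : ∀ cfg, Steps cfg [] 0 cfg
  | step : ∀ {cfg : Config} {α : Label} {cfg' : Config} {ls : List Label} {n : ℕ} {cfg'' : Config},
      Step cfg α cfg' → Steps cfg' ls n cfg'' → Steps cfg (α.consTo ls) (n+1) cfg''

/-- Projection of a label list to the values output on channel `a`. -/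
def projA (a : Chan) (ls : List Label) : List Val :=
  ls.filterMap fun l => match l with
    | .silent => none
    | .out b v _ => if b = a then some v else none

/-- `⟨c,σ⟩ ⇒t_a,n ⟨c',σ'⟩`: n steps producing trace `t` of values on channel `a`. -/
def ProjSteps (cfg : Config) (a : Chan) (t : List Val) (n : ℕ) (cfg' : Config) : Prop :=
  ∃ ls, Steps cfg ls n cfg' ∧ projA a ls = t

/-- `⟨c,σ⟩ ⇒t_a`: the run of `c` from `σ` produces trace `t` on channel `a`. -/
def Produces (c : Cmd) (σ : Store) (a : Chan) (t : List Val) : Prop :=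
  ∃ n cfg', ProjSteps (c, σ) a t n cfg'

/-- A forgetful attacker: a deterministic automaton over values. -/
structure Attacker (S : Type) where
  init : S
  step : S → Val → S

/-- The attacker's state after observing trace `t`. -/
def Attacker.run {S : Type} (A : Attacker S) (t : List Val) : S :=
  t.foldl A.step A.init

/-- The counting variant `A^ω` of an attacker. -/
def Attacker.omega {S : Type} (A : Attacker S) : Attacker (S × ℕ) where
  init := (A.init, 0)
  step := fun sn v => (A.step sn.1 v, sn.2 + 1)

/-- Attacker knowledge `k(A,c,a,t)`. -/
def know {S : Type} (A : Attacker S) (c : Cmd) (a : Chan) (t : List Val) : Set Store :=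
  { ρ | ∃ t', Produces c ρ a t' ∧ A.run t' = A.run t }

/-- Exclusion knowledge `ek(A,c,a,t)`. -/
def ek {S : Type} (A : Attacker S) (c : Cmd) (a : Chan) (t : List Val) : Set Store :=
  (know A c a t)ᶜ

/-- Full progress knowledge `k#(A,c,a,t)`. -/
def kSharp {S : Type} (A : Attacker S) (c : Cmd) (a : Chan) (t : List Val) : Set Store :=
  { ρ | ∃ t' v, Produces c ρ a (t' ++ [v]) ∧ A.omega.run t' = A.omega.run t }

/-- Exclusion version `ek#(A,c,a,t)`. -/
def ekSharp {S : Type} (A : Attacker S) (c : Cmd) (a : Chan) (t : List Val) : Set Store :=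
  (kSharp A c a t)ᶜ

/-- AC progress knowledge `k⁺(A,c,a,t)`. -/
def kPlus {S : Type} (A : Attacker S) (c : Cmd) (a : Chan) (t : List Val) : Set Store :=
  { ρ | ∃ t' v, Produces c ρ a (t' ++ [v]) ∧ A.run t' = A.run t }

/-- Exclusion version `ek⁺(A,c,a,t)`. -/
def ekPlus {S : Type} (A : Attacker S) (c : Cmd) (a : Chan) (t : List Val) : Set Store :=
  (kPlus A c a t)ᶜ

/-- A dynamic policy: an equivalence relation on stores per channel and execution point. -/
structure DynPolicy where
  rel : Chan → Cmd → Store → ℕ → Store → Store → Prop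
  isEquiv : ∀ a c σ n, Equivalence (rel a c σ n)

/-- Progress-insensitive security of `c` for policy `D` against attacker `A`
on channel `a` for initial store `σ`. -/
def PISecure {S : Type} (c : Cmd) (D : DynPolicy) (A : Attacker S) (a : Chan) (σ : Store) : Prop :=
  ∀ t n c' σ' v, ProjSteps (c, σ) a t n (c', σ') →
    (∃ cfg', ProjSteps (c', σ') a [v] 1 cfg') →
    ek A c a (t ++ [v]) \ ekSharp A c a t ⊆ { ρ | ¬ D.rel a c σ n ρ σ }

/-- AC progress-insensitive security of `c` for policy `D` against attacker `A`
on channel `a` for initial store `σ`. -/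
def ACPISecure {S : Type} (c : Cmd) (D : DynPolicy) (A : Attacker S) (a : Chan) (σ : Store) : Prop :=
  ∀ t n c' σ' v, ProjSteps (c, σ) a t n (c', σ') →
    (∃ cfg', ProjSteps (c', σ') a [v] 1 cfg') →
    ek A c a (t ++ [v]) \ ekPlus A c a t ⊆ { ρ | ¬ D.rel a c σ n ρ σ }

/-- Two-run progress-insensitive security. -/
def TwoRunPISecure (c : Cmd) (D : DynPolicy) (a : Chan) (σ : Store) : Prop :=
  ∀ t n cn σn v, ProjSteps (c, σ) a t n (cn, σn) →
    (∃ cfg', ProjSteps (cn, σn) a [v] 1 cfg') →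
    ∀ ρ t' v', D.rel a c σ n ρ σ → Produces c ρ a (t' ++ [v']) → t'.length = t.length →
      v' = v

/-- A counting attacker always remembers at least how many outputs it has seen. -/
def Attacker.Counting {S : Type} (A : Attacker S) : Prop :=
  ∀ t t' : List Val, A.run t = A.run t' → t.length = t'.length

/-- A command is quasi-constant if, per channel, all its traces are prefixes of
one fixed (possibly infinite) trace. -/
def QuasiConstant (c : Cmd) : Prop :=
  ∀ a : Chan, ∃ u : ℕ → Val, ∀ σ t, Produces c σ a t →
    ∀ i : Fin t.length, t.get i = u i.val

/-- The variables of the dependency type system. -/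
inductive TVar where
  | pvar : PVar → TVar
  | cpoint : Chan → PPoint → TVar
  | pc : TVar
  | chan : Chan → TVar
deriving DecidableEq

/-- Type environments. -/
abbrev Env := TVar → Set TVar

/-- The identity environment. -/
def idEnv : Env := fun x => {x}

/-- Sequential composition of environments: `(Γ₂;Γ₁)(x) = ⋃_{y ∈ Γ₂(x)} Γ₁(y)`. -/
def envComp (Γ₂ Γ₁ : Env) : Env := fun x => ⋃ y ∈ Γ₂ x, Γ₁ y

/-- Pointwise union of environments. -/
def envUnion (Γ₁ Γ₂ : Env) : Env := fun x => Γ₁ x ∪ Γ₂ x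

/-- Iterates of an environment. -/
def envIter (Γ : Env) : ℕ → Env
  | 0 => idEnv
  | n+1 => envComp (envIter Γ n) Γ

/-- The fixed point `Γ* = ⋃_{n≥0} Γⁿ`. -/
def envStar (Γ : Env) : Env := fun x => ⋃ n, envIter Γ n x

/-- Free variables of an expression, as type-system variables. -/
def fvT (e : Expr) : Set TVar := TVar.pvar '' e.fv

/-- The dependency type system `⊢{c}Γ`. -/
inductive Typing : Cmd → Env → Prop where
  | skip : Typing .skip idEnv
  | assign : ∀ (x : PVar) (e : Expr),
      Typing (.assign x e) (Function.update idEnv (.pvar x) (fvT e ∪ {TVar.pc}))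
  | seq : ∀ {c₁ : Cmd} {Γ₁ : Env} {c₂ : Cmd} {Γ₂ : Env},
      Typing c₁ Γ₁ → Typing c₂ Γ₂ → Typing (.seq c₁ c₂) (envComp Γ₂ Γ₁)
  | ite : ∀ {e : Expr} {c₁ : Cmd} {Γ₁ : Env} {c₂ : Cmd} {Γ₂ : Env},
      Typing c₁ Γ₁ → Typing c₂ Γ₂ →
      Typing (.ite e c₁ c₂)
        (Function.update
          (envUnion (envComp Γ₁ (Function.update idEnv .pc ({TVar.pc} ∪ fvT e)))
                    (envComp Γ₂ (Function.update idEnv .pc ({TVar.pc} ∪ fvT e))))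
          .pc {TVar.pc})
  | whileT : ∀ {e : Expr} {c : Cmd} {Γc : Env}, Typing c Γc →
      Typing (.while e c)
        (Function.update
          (envStar (envComp Γc (Function.update idEnv .pc ({TVar.pc} ∪ fvT e))))
          .pc {TVar.pc})
  | out : ∀ (e : Expr) (a : Chan) (p : PPoint),
      Typing (.out e a p)
        (Function.update
          (Function.update idEnv (.cpoint a p)
            (fvT e ∪ {TVar.pc, TVar.chan a, TVar.cpoint a p}))
          (.chan a) {TVar.pc, TVar.chan a})

/-- `σ ≡_{Γ(x)} ρ`: the stores agree on all program variables in `Γ(x)`. -/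
def eqG (Γ : Env) (x : TVar) (σ ρ : Store) : Prop :=
  ∀ y : PVar, TVar.pvar y ∈ Γ x → σ y = ρ y

/-- A dynamic policy approximation: an equivalence relation on stores per
channel–program-point pair. -/
structure PolApprox where
  rel : Chan → PPoint → Store → Store → Prop
  isEquiv : ∀ a p, Equivalence (rel a p)

/-- `c : A` is a sound approximation of dynamic policy `D`. -/
def SoundApprox (c : Cmd) (A : PolApprox) (D : DynPolicy) : Prop :=
  ∀ σ n ls c' σ' a v p cfg'',
    Steps (c, σ) ls n (c', σ') → Step (c', σ') (.out a v p) cfg'' →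
    ∀ ρ₁ ρ₂, D.rel a c σ n ρ₁ ρ₂ → A.rel a p ρ₁ ρ₂


/-- Big-step (partial or terminating) runs, recording the outputs on channel `a`. -/
inductive BS (a : Chan) : Cmd → Store → List (Val × PPoint) → Option Store → Prop where
  | part : ∀ c σ, BS a c σ [] none
  | skip : ∀ σ, BS a .skip σ [] (some σ)
  | assign : ∀ x e σ, BS a (.assign x e) σ [] (some (Function.update σ x (e.eval σ)))
  | outSame : ∀ e p σ, BS a (.out e a p) σ [(e.eval σ, p)] (some σ)
  | outPart : ∀ e p σ, BS a (.out e a p) σ [(e.eval σ, p)] none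
  | outDiff : ∀ e b p σ, b ≠ a → BS a (.out e b p) σ [] (some σ)
  | seqP : ∀ {c₁ σ us} (c₂ : Cmd), BS a c₁ σ us none → BS a (.seq c₁ c₂) σ us none
  | seqT : ∀ {c₁ c₂ σ us σ₁ us' r}, BS a c₁ σ us (some σ₁) → BS a c₂ σ₁ us' r →
      BS a (.seq c₁ c₂) σ (us ++ us') r
  | iteT : ∀ {e c₁ σ us r} (c₂ : Cmd), e.eval σ ≠ 0 → BS a c₁ σ us r →
      BS a (.ite e c₁ c₂) σ us r
  | iteF : ∀ {e c₂ σ us r} (c₁ : Cmd), e.eval σ = 0 → BS a c₂ σ us r →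
      BS a (.ite e c₁ c₂) σ us r
  | whileF : ∀ {e σ} (c : Cmd), e.eval σ = 0 → BS a (.while e c) σ [] (some σ)
  | whileP : ∀ {e c σ us}, e.eval σ ≠ 0 → BS a c σ us none → BS a (.while e c) σ us none
  | whileT : ∀ {e c σ us σ₁ us' r}, e.eval σ ≠ 0 → BS a c σ us (some σ₁) →
      BS a (.while e c) σ₁ us' r → BS a (.while e c) σ (us ++ us') r

/-- Projection keeping program points. -/
def projP (a : Chan) : List Label → List (Val × PPoint)
  | [] => []
  | .silent :: ls => projP a ls
  | .out b v p :: ls => if b = a then (v, p) :: projP a ls else projP a ls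

theorem projP_fst (a : Chan) (ls : List Label) : (projP a ls).map Prod.fst = projA a ls := by
  induction ls with
  | nil => rfl
  | cons l ls ih =>
    cases l with
    | silent => simpa [projP, projA] using ih
    | out b v p =>
      by_cases h : b = a
      · simpa [projP, projA, h] using ih
      · simpa [projP, projA, h] using ih

theorem projP_cons (a : Chan) (l : Label) (ls : List Label) :
    projP a (l.consTo ls) = projP a [l] ++ projP a ls := by
  cases l with
  | silent => simp [Label.consTo, projP]
  | out b v p =>
    by_cases h : b = a <;> simp [Label.consTo, projP, h]

theorem BS_step {a : Chan} {cfg cfg' : Config} {α : Label} (h : Step cfg α cfg') :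
    ∀ us r, BS a cfg'.1 cfg'.2 us r → BS a cfg.1 cfg.2 (projP a [α] ++ us) r := by
  induction h with
  | skipSeq c σ =>
    intro us r hb
    exact BS.seqT (BS.skip σ) hb
  | seq c₂ h ih =>
    intro us r hb
    simp only at hb ih ⊢
    cases hb with
    | part => exact BS.seqP _ (ih _ _ (BS.part _ _))
    | seqP _ hb => exact BS.seqP _ (ih _ _ hb)
    | seqT h1 h2 =>
      rw [← List.append_assoc]
      exact BS.seqT (ih _ _ h1) h2
  | assign x e σ =>
    intro us r hb
    simp only [projP, List.nil_append] at hb ⊢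
    cases hb with
    | part => exact BS.part _ _
    | skip => exact BS.assign x e σ
  | out e b p σ =>
    intro us r hb
    simp only at hb ⊢
    by_cases hba : b = a
    · subst hba
      have hh := BS.outSame (a := b) e p σ
      simp only [projP, if_true]
      cases hb with
      | part =>
        exact BS.outPart e p σ
      | skip => simpa using hh
    · simp only [projP, hba, if_false, List.nil_append]
      cases hb with
      | part => exact BS.part _ _
      | skip => exact BS.outDiff e b p σ hba
  | whileStep e c σ =>
    intro us r hb
    simp only [projP, List.nil_append] at hb ⊢
    cases hb with
    | part => exact BS.part _ _
    | iteT _ he hb =>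
      cases hb with
      | part => exact BS.part _ _
      | seqP _ hb => exact BS.whileP he hb
      | seqT h1 h2 => exact BS.whileT he h1 h2
    | iteF _ he hb =>
      cases hb with
      | part => exact BS.part _ _
      | skip => exact BS.whileF c he
  | iteTrue c₁ c₂ he =>
    intro us r hb
    exact BS.iteT _ he hb
  | iteFalse c₁ c₂ he =>
    intro us r hb
    exact BS.iteF _ he hb

theorem BS_steps {a : Chan} {cfg cfg' : Config} {ls : List Label} {n : ℕ}
    (h : Steps cfg ls n cfg') :
    ∀ us r, BS a cfg'.1 cfg'.2 us r → BS a cfg.1 cfg.2 (projP a ls ++ us) r := by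
  induction h with
  | refl cfg => intro us r hb; simpa [projP] using hb
  | step h1 _ ih =>
    intro us r hb
    rw [projP_cons, List.append_assoc]
    exact BS_step h1 _ _ (ih _ _ hb)

/-- Agreement on the program variables of a set. -/
def eqS (s : Set TVar) (σ ρ : Store) : Prop := ∀ y : PVar, TVar.pvar y ∈ s → σ y = ρ y

theorem eqS.mono {s t : Set TVar} {σ ρ : Store} (h : eqS t σ ρ) (hst : s ⊆ t) : eqS s σ ρ :=
  fun y hy => h y (hst hy)

theorem eqS.symm {s : Set TVar} {σ ρ : Store} (h : eqS s σ ρ) : eqS s ρ σ :=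
  fun y hy => (h y hy).symm

theorem eqS.eval {e : Expr} {s : Set TVar} {σ ρ : Store} (h : eqS s σ ρ) (he : fvT e ⊆ s) :
    e.eval σ = e.eval ρ := by
  cases e with
  | const v => rfl
  | var x => exact h x (he ⟨x, rfl, rfl⟩)

/-- Semantic soundness of an environment together with its structural facts. -/
structure Good (a : Chan) (c : Cmd) (Γ : Env) : Prop where
  pcE : Γ .pc = {TVar.pc}
  chanR : ∀ b, TVar.chan b ∈ Γ (.chan b)
  cpR : ∀ b p, TVar.cpoint b p ∈ Γ (.cpoint b p)
  varM : ∀ x, TVar.pc ∈ Γ (.pvar x) ∨ (TVar.pvar x ∈ Γ (.pvar x) ∧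
    ∀ σ us σ', BS a c σ us (some σ') → σ' x = σ x)
  chanM : TVar.pc ∈ Γ (.chan a) ∨ ∀ σ us r, BS a c σ us r → us = []
  cpM : ∀ σ us r v p, BS a c σ us r → (v, p) ∈ us →
    TVar.pc ∈ Γ (.cpoint a p) ∧ TVar.chan a ∈ Γ (.cpoint a p)
  t1 : ∀ x σ ρ us vs σ' ρ', eqS (Γ (.pvar x)) σ ρ → BS a c σ us (some σ') →
    BS a c ρ vs (some ρ') → σ' x = ρ' x
  t2 : ∀ σ ρ us vs σ' r, eqS (Γ (.chan a)) σ ρ → BS a c σ us (some σ') →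
    BS a c ρ vs r → vs.length ≤ us.length
  t3 : ∀ σ ρ us vs r r' k v p, eqS (Γ (.cpoint a p)) σ ρ → BS a c σ us r →
    BS a c ρ vs r' → us[k]? = some (v, p) →
    vs[k]? = some (v, p) ∨ (vs.length ≤ k ∧ r' = none)

theorem good_skip (a : Chan) : Good a .skip idEnv where
  pcE := rfl
  chanR _ := rfl
  cpR _ _ := rfl
  varM x := Or.inr ⟨rfl, by intro σ us σ' h; cases h; rfl⟩
  chanM := Or.inr (by intro σ us r h; cases h <;> rfl)
  cpM := by intro σ us r v p h hm; cases h <;> simp at hm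
  t1 := by
    intro x σ ρ us vs σ' ρ' he h1 h2
    cases h1; cases h2
    exact he x rfl
  t2 := by
    intro σ ρ us vs σ' r he h1 h2
    cases h1; cases h2 <;> simp
  t3 := by
    intro σ ρ us vs r r' k v p he h1 h2 hk
    cases h1 <;> simp at hk

theorem good_assign (a : Chan) (x : PVar) (e : Expr) :
    Good a (.assign x e) (Function.update idEnv (.pvar x) (fvT e ∪ {TVar.pc})) where
  pcE := by simp [idEnv]
  chanR _ := by simp [idEnv]
  cpR _ _ := by simp [idEnv]
  varM y := by
    by_cases h : y = x
    · subst h; left; simp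
    · right
      refine ⟨by simp [idEnv, h], ?_⟩
      intro σ us σ' hb; cases hb; simp [h]
  chanM := Or.inr (by intro σ us r h; cases h <;> rfl)
  cpM := by intro σ us r v p h hm; cases h <;> simp at hm
  t1 := by
    intro y σ ρ us vs σ' ρ' he h1 h2
    cases h1; cases h2
    by_cases h : y = x
    · subst h
      simp only [Function.update_self] at he ⊢
      exact he.eval Set.subset_union_left
    · simp only [Function.update_of_ne h]
      exact he y (by simp [idEnv, h])
  t2 := by
    intro σ ρ us vs σ' r he h1 h2
    cases h1; cases h2 <;> simp
  t3 := by
    intro σ ρ us vs r r' k v p he h1 h2 hk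
    cases h1 <;> simp at hk

theorem BS_out_cases {a b : Chan} {e : Expr} {p : PPoint} {σ : Store}
    {us : List (Val × PPoint)} {r : Option Store} (h : BS a (.out e b p) σ us r) :
    (us = [] ∧ r = none) ∨ (b = a ∧ us = [(e.eval σ, p)] ∧ (r = none ∨ r = some σ)) ∨
      (b ≠ a ∧ us = [] ∧ r = some σ) := by
  cases h <;> simp_all

theorem good_out (a : Chan) (e : Expr) (b : Chan) (q : PPoint) :
    Good a (.out e b q) (Function.update
          (Function.update idEnv (.cpoint b q)
            (fvT e ∪ {TVar.pc, TVar.chan b, TVar.cpoint b q}))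
          (.chan b) {TVar.pc, TVar.chan b}) where
  pcE := by simp [idEnv]
  chanR d := by
    by_cases h : d = b
    · subst h; simp
    · simp [idEnv, h]
  cpR d p := by
    by_cases h : TVar.cpoint d p = TVar.cpoint b q
    · rw [h]; simp
    · rw [Function.update_of_ne (by simp), Function.update_of_ne h]; rfl
  varM y := by
    right
    refine ⟨by simp [idEnv], ?_⟩
    intro σ us σ' hb
    rcases BS_out_cases hb with h | h | h <;> simp_all
  chanM := by
    by_cases h : b = a
    · left; subst h; simp
    · right
      intro σ us r hb
      rcases BS_out_cases hb with h | h | h <;> simp_all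
  cpM := by
    intro σ us r v p hb hm
    rcases BS_out_cases hb with h | ⟨h, h', -⟩ | h
    · simp_all
    · subst h; subst h'
      simp only [List.mem_singleton, Prod.mk.injEq] at hm
      rw [hm.2]; simp
    · simp_all
  t1 := by
    intro y σ ρ us vs σ' ρ' he h1 h2
    have := he y (by simp [idEnv])
    rcases BS_out_cases h1 with h | h | h <;> rcases BS_out_cases h2 with h' | h' | h' <;> simp_all
  t2 := by
    intro σ ρ us vs σ' r he h1 h2
    rcases BS_out_cases h1 with h | h | h <;> rcases BS_out_cases h2 with h' | h' | h' <;> simp_all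
  t3 := by
    intro σ ρ us vs r r' k v p he h1 h2 hk
    rcases BS_out_cases h1 with ⟨h, -⟩ | ⟨h, h', -⟩ | ⟨-, h, -⟩
    · simp [h] at hk
    · subst h; subst h'
      rcases k with _ | k
      · simp only [List.getElem?_cons_zero, Option.some.injEq, Prod.mk.injEq] at hk
        obtain ⟨hk1, hk2⟩ := hk
        subst hk2
        have hev : e.eval σ = e.eval ρ := he.eval (by intro z hz; simp [hz])
        rcases BS_out_cases h2 with h | h | h
        · simp [h]
        · left; simp [h, ← hk1, hev]
        · simp at h
      · simp at hk
    · simp [h] at hk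

theorem mem_comp {Γ₂ Γ₁ : Env} {x y z : TVar} (h2 : y ∈ Γ₂ x) (h1 : z ∈ Γ₁ y) :
    z ∈ envComp Γ₂ Γ₁ x := Set.mem_biUnion h2 h1

theorem sub_comp {Γ₂ Γ₁ : Env} {x y : TVar} (h2 : y ∈ Γ₂ x) : Γ₁ y ⊆ envComp Γ₂ Γ₁ x :=
  fun _ h1 => mem_comp h2 h1

theorem BS_seq_cases {a : Chan} {c₁ c₂ : Cmd} {σ : Store}
    {us : List (Val × PPoint)} {r : Option Store} (h : BS a (.seq c₁ c₂) σ us r) :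
    (BS a c₁ σ us none ∧ r = none) ∨
      ∃ σ₁ us₁ us₂, us = us₁ ++ us₂ ∧ BS a c₁ σ us₁ (some σ₁) ∧ BS a c₂ σ₁ us₂ r := by
  cases h with
  | part => exact Or.inl ⟨BS.part _ _, rfl⟩
  | seqP _ h => exact Or.inl ⟨h, rfl⟩
  | seqT h1 h2 => exact Or.inr ⟨_, _, _, rfl, h1, h2⟩

/-- First phase of a sequential composition, in the form used for `seq` and loops. -/
theorem Good.t3_app {a : Chan} {c : Cmd} {Γ : Env} (g : Good a c Γ)
    {σ ρ σ₁ : Store} {us vs vs' : List (Val × PPoint)} {r : Option Store} {k : ℕ} {v : Val}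
    {p : PPoint} (he : eqS (Γ (.cpoint a p)) σ ρ) (h1 : BS a c σ us r)
    (h2 : BS a c ρ vs (some σ₁)) (hk : us[k]? = some (v, p)) :
    (vs ++ vs')[k]? = some (v, p) := by
  rcases g.t3 _ _ _ _ _ _ k v p he h1 h2 hk with h | h
  · have : k < vs.length := by
      by_contra hc
      rw [List.getElem?_eq_none (by omega)] at h
      simp at h
    rw [List.getElem?_append_left this, h]
  · simp at h

theorem Good.t1S {a : Chan} {c : Cmd} {Γ : Env} (g : Good a c Γ) {s t : Set TVar}
    {σ ρ σ' ρ' : Store} {us vs : List (Val × PPoint)}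
    (hs : ∀ y ∈ t, Γ y ⊆ s) (he : eqS s σ ρ)
    (h1 : BS a c σ us (some σ')) (h2 : BS a c ρ vs (some ρ')) : eqS t σ' ρ' :=
  fun y hy => g.t1 y _ _ _ _ _ _ (he.mono (hs _ hy)) h1 h2

theorem Good.t2E {a : Chan} {c : Cmd} {Γ : Env} (g : Good a c Γ)
    {σ ρ σ' ρ' : Store} {us vs : List (Val × PPoint)} (he : eqS (Γ (.chan a)) σ ρ)
    (h1 : BS a c σ us (some σ')) (h2 : BS a c ρ vs (some ρ')) : us.length = vs.length :=
  le_antisymm (g.t2 _ _ _ _ _ _ he.symm h2 h1) (g.t2 _ _ _ _ _ _ he h1 h2)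

theorem good_seq {a : Chan} {c₁ c₂ : Cmd} {Γ₁ Γ₂ : Env} (g1 : Good a c₁ Γ₁)
    (g2 : Good a c₂ Γ₂) : Good a (.seq c₁ c₂) (envComp Γ₂ Γ₁) where
  pcE := by simp [envComp, g1.pcE, g2.pcE]
  chanR b := mem_comp (g2.chanR b) (g1.chanR b)
  cpR b p := mem_comp (g2.cpR b p) (g1.cpR b p)
  varM x := by
    rcases g2.varM x with h2 | ⟨h2, h2'⟩
    · left; exact mem_comp h2 (by rw [g1.pcE]; rfl)
    · rcases g1.varM x with h1 | ⟨h1, h1'⟩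
      · left; exact mem_comp h2 h1
      · right
        refine ⟨mem_comp h2 h1, ?_⟩
        intro σ us σ' h
        rcases BS_seq_cases h with ⟨-, h⟩ | ⟨σ₁, us₁, us₂, -, hb1, hb2⟩
        · simp at h
        · rw [h2' _ _ _ hb2, h1' _ _ _ hb1]
  chanM := by
    rcases g2.chanM with h2 | h2
    · left; exact mem_comp h2 (by rw [g1.pcE]; rfl)
    · rcases g1.chanM with h1 | h1
      · left; exact mem_comp (g2.chanR a) h1
      · right
        intro σ us r h
        rcases BS_seq_cases h with ⟨h, -⟩ | ⟨σ₁, us₁, us₂, rfl, hb1, hb2⟩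
        · exact h1 _ _ _ h
        · rw [h1 _ _ _ hb1, h2 _ _ _ hb2]; rfl
  cpM := by
    have k1 : ∀ σ us r v p, BS a c₁ σ us r → (v, p) ∈ us →
        TVar.pc ∈ envComp Γ₂ Γ₁ (.cpoint a p) ∧ TVar.chan a ∈ envComp Γ₂ Γ₁ (.cpoint a p) := by
      intro σ us r v p h hm
      have := g1.cpM _ _ _ _ _ h hm
      exact ⟨mem_comp (g2.cpR a p) this.1, mem_comp (g2.cpR a p) this.2⟩
    intro σ us r v p h hm
    rcases BS_seq_cases h with ⟨h, -⟩ | ⟨σ₁, us₁, us₂, rfl, hb1, hb2⟩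
    · exact k1 _ _ _ _ _ h hm
    · rcases List.mem_append.1 hm with hm | hm
      · exact k1 _ _ _ _ _ hb1 hm
      · have := g2.cpM _ _ _ _ _ hb2 hm
        exact ⟨mem_comp this.1 (by rw [g1.pcE]; rfl), mem_comp this.2 (g1.chanR a)⟩
  t1 := by
    intro x σ ρ us vs σ' ρ' he h1 h2
    rcases BS_seq_cases h1 with ⟨-, h⟩ | ⟨σ₁, us₁, us₂, rfl, a1, a2⟩
    · simp at h
    rcases BS_seq_cases h2 with ⟨-, h⟩ | ⟨ρ₁, vs₁, vs₂, rfl, b1, b2⟩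
    · simp at h
    exact g2.t1 x _ _ _ _ _ _ (g1.t1S (fun y hy => sub_comp hy) he a1 b1) a2 b2
  t2 := by
    intro σ ρ us vs σ' r he h1 h2
    have hc := he.mono (sub_comp (g2.chanR a))
    rcases BS_seq_cases h1 with ⟨-, h⟩ | ⟨σ₁, us₁, us₂, rfl, a1, a2⟩
    · simp at h
    rcases BS_seq_cases h2 with ⟨h, -⟩ | ⟨ρ₁, vs₁, vs₂, rfl, b1, b2⟩
    · have := g1.t2 _ _ _ _ _ _ hc a1 h
      simp; omega
    · have e1 := g1.t2 _ _ _ _ _ _ hc a1 b1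
      have e2 := g2.t2 _ _ _ _ _ _ (g1.t1S (fun y hy => sub_comp hy) he a1 b1) a2 b2
      simp; omega
  t3 := by
    intro σ ρ us vs r r' k v p he h1 h2 hk
    have hc := he.mono (sub_comp (g2.cpR a p))
    have key : ∀ us₁ r₁, BS a c₁ σ us₁ r₁ → us₁[k]? = some (v, p) →
        vs[k]? = some (v, p) ∨ (vs.length ≤ k ∧ r' = none) := by
      intro us₁ r₁ ha hk
      rcases BS_seq_cases h2 with ⟨h, rfl⟩ | ⟨ρ₁, vs₁, vs₂, rfl, b1, b2⟩
      · exact g1.t3 _ _ _ _ _ _ _ _ _ hc ha h hk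
      · exact Or.inl (g1.t3_app hc ha b1 hk)
    rcases BS_seq_cases h1 with ⟨h, -⟩ | ⟨σ₁, us₁, us₂, rfl, a1, a2⟩
    · exact key _ _ h hk
    · by_cases hlt : k < us₁.length
      · rw [List.getElem?_append_left hlt] at hk
        exact key _ _ a1 hk
      · push Not at hlt
        rw [List.getElem?_append_right hlt] at hk
        have hm := g2.cpM _ _ _ _ _ a2 (List.mem_of_getElem? hk)
        have hch := he.mono (sub_comp hm.2)
        rcases BS_seq_cases h2 with ⟨h, rfl⟩ | ⟨ρ₁, vs₁, vs₂, rfl, b1, b2⟩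
        · have := g1.t2 _ _ _ _ _ _ hch a1 h
          exact Or.inr ⟨by omega, rfl⟩
        · have hl := g1.t2E hch a1 b1
          have := g2.t3 _ _ _ _ _ _ _ v p (g1.t1S (fun y hy => sub_comp hy) he a1 b1) a2 b2 hk
          rw [List.getElem?_append_right (by omega), List.length_append, ← hl]
          rcases this with h | h
          · exact Or.inl h
          · exact Or.inr ⟨by omega, h.2⟩

/-- The environment raising `pc` by the guard. -/
abbrev guardEnv (e : Expr) : Env := Function.update idEnv .pc ({TVar.pc} ∪ fvT e)

theorem guard_self (e : Expr) (y : TVar) : y ∈ guardEnv e y := by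
  by_cases h : y = .pc
  · subst h; simp [guardEnv]
  · simp [guardEnv, h, idEnv]

theorem guard_sub (Γ : Env) (e : Expr) (x : TVar) : Γ x ⊆ envComp Γ (guardEnv e) x :=
  fun y hy => mem_comp hy (guard_self e y)

theorem guard_fv {Γ : Env} {e : Expr} {x : TVar} (h : TVar.pc ∈ Γ x) :
    fvT e ⊆ envComp Γ (guardEnv e) x :=
  fun y hy => mem_comp h (by simp [guardEnv, hy])

theorem BS_ite_cases {a : Chan} {e : Expr} {c₁ c₂ : Cmd} {σ : Store}
    {us : List (Val × PPoint)} {r : Option Store} (h : BS a (.ite e c₁ c₂) σ us r) :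
    (us = [] ∧ r = none) ∨ (e.eval σ ≠ 0 ∧ BS a c₁ σ us r) ∨ (e.eval σ = 0 ∧ BS a c₂ σ us r) := by
  cases h with
  | part => exact Or.inl ⟨rfl, rfl⟩
  | iteT _ h h' => exact Or.inr (Or.inl ⟨h, h'⟩)
  | iteF _ h h' => exact Or.inr (Or.inr ⟨h, h'⟩)

theorem good_ite {a : Chan} {e : Expr} {c₁ c₂ : Cmd} {Γ₁ Γ₂ : Env} (g1 : Good a c₁ Γ₁)
    (g2 : Good a c₂ Γ₂) : Good a (.ite e c₁ c₂) (Function.update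
          (envUnion (envComp Γ₁ (guardEnv e)) (envComp Γ₂ (guardEnv e))) .pc {TVar.pc}) := by
  generalize hF : (Function.update
      (envUnion (envComp Γ₁ (guardEnv e)) (envComp Γ₂ (guardEnv e))) .pc {TVar.pc}) = F
  have hpc : F .pc = {TVar.pc} := by subst hF; simp
  have s1 : ∀ x, x ≠ .pc → Γ₁ x ⊆ F x := by
    intro x hx; subst hF; rw [Function.update_of_ne hx]
    exact (guard_sub Γ₁ e x).trans Set.subset_union_left
  have s2 : ∀ x, x ≠ .pc → Γ₂ x ⊆ F x := by
    intro x hx; subst hF; rw [Function.update_of_ne hx]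
    exact (guard_sub Γ₂ e x).trans Set.subset_union_right
  have f1 : ∀ x, x ≠ .pc → TVar.pc ∈ Γ₁ x → fvT e ⊆ F x := by
    intro x hx h; subst hF; rw [Function.update_of_ne hx]
    exact (guard_fv h).trans Set.subset_union_left
  have f2 : ∀ x, x ≠ .pc → TVar.pc ∈ Γ₂ x → fvT e ⊆ F x := by
    intro x hx h; subst hF; rw [Function.update_of_ne hx]
    exact (guard_fv h).trans Set.subset_union_right
  clear hF
  refine ⟨hpc, fun b => s1 _ (by simp) (g1.chanR b), fun b p => s1 _ (by simp) (g1.cpR b p),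
    ?_, ?_, ?_, ?_, ?_, ?_⟩
  · intro x
    rcases g1.varM x with h1 | ⟨h1, h1'⟩
    · left; exact s1 _ (by simp) h1
    rcases g2.varM x with h2 | ⟨h2, h2'⟩
    · left; exact s2 _ (by simp) h2
    right
    refine ⟨s1 _ (by simp) h1, ?_⟩
    intro σ us σ' h
    rcases BS_ite_cases h with h | ⟨-, h⟩ | ⟨-, h⟩
    · simp at h
    · exact h1' _ _ _ h
    · exact h2' _ _ _ h
  · rcases g1.chanM with h1 | h1
    · left; exact s1 _ (by simp) h1
    rcases g2.chanM with h2 | h2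
    · left; exact s2 _ (by simp) h2
    right
    intro σ us r h
    rcases BS_ite_cases h with h | ⟨-, h⟩ | ⟨-, h⟩
    · exact h.1
    · exact h1 _ _ _ h
    · exact h2 _ _ _ h
  · intro σ us r v p h hm
    rcases BS_ite_cases h with h | ⟨-, h⟩ | ⟨-, h⟩
    · simp [h.1] at hm
    · have := g1.cpM _ _ _ _ _ h hm
      exact ⟨s1 _ (by simp) this.1, s1 _ (by simp) this.2⟩
    · have := g2.cpM _ _ _ _ _ h hm
      exact ⟨s2 _ (by simp) this.1, s2 _ (by simp) this.2⟩
  · intro x σ ρ us vs σ' ρ' he h1 h2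
    have hd : fvT e ⊆ F (.pvar x) ∨ (TVar.pvar x ∈ F (.pvar x) ∧
        ∀ σ us σ', BS a (.ite e c₁ c₂) σ us (some σ') → σ' x = σ x) := by
      rcases g1.varM x with h1 | ⟨h1, h1'⟩
      · left; exact f1 _ (by simp) h1
      rcases g2.varM x with h2 | ⟨h2, h2'⟩
      · left; exact f2 _ (by simp) h2
      right
      refine ⟨s1 _ (by simp) h1, ?_⟩
      intro σ us σ' h
      rcases BS_ite_cases h with h | ⟨-, h⟩ | ⟨-, h⟩
      · simp at h
      · exact h1' _ _ _ h
      · exact h2' _ _ _ h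
    rcases hd with hd | ⟨hd, hd'⟩
    · have hev := he.eval hd
      rcases BS_ite_cases h1 with h | ⟨ha, h⟩ | ⟨ha, h⟩
      · simp at h
      · rcases BS_ite_cases h2 with h' | ⟨hb, h'⟩ | ⟨hb, h'⟩
        · simp at h'
        · exact g1.t1 x _ _ _ _ _ _ (he.mono (s1 _ (by simp))) h h'
        · rw [hev] at ha; exact absurd hb ha
      · rcases BS_ite_cases h2 with h' | ⟨hb, h'⟩ | ⟨hb, h'⟩
        · simp at h'
        · rw [hev] at ha; exact absurd ha hb
        · exact g2.t1 x _ _ _ _ _ _ (he.mono (s2 _ (by simp))) h h'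
    · rw [hd' _ _ _ h1, hd' _ _ _ h2]
      exact he x hd
  · intro σ ρ us vs σ' r he h1 h2
    have hd : fvT e ⊆ F (.chan a) ∨ vs = [] := by
      rcases g1.chanM with k1 | k1
      · left; exact f1 _ (by simp) k1
      rcases g2.chanM with k2 | k2
      · left; exact f2 _ (by simp) k2
      right
      rcases BS_ite_cases h2 with h | ⟨-, h⟩ | ⟨-, h⟩
      · exact h.1
      · exact k1 _ _ _ h
      · exact k2 _ _ _ h
    rcases hd with hd | hd
    · have hev := he.eval hd
      rcases BS_ite_cases h2 with h' | ⟨hb, h'⟩ | ⟨hb, h'⟩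
      · simp [h'.1]
      · rcases BS_ite_cases h1 with h | ⟨ha, h⟩ | ⟨ha, h⟩
        · simp at h
        · exact g1.t2 _ _ _ _ _ _ (he.mono (s1 _ (by simp))) h h'
        · rw [hev] at ha; exact absurd ha hb
      · rcases BS_ite_cases h1 with h | ⟨ha, h⟩ | ⟨ha, h⟩
        · simp at h
        · rw [hev] at ha; exact absurd hb ha
        · exact g2.t2 _ _ _ _ _ _ (he.mono (s2 _ (by simp))) h h'
    · simp [hd]
  · intro σ ρ us vs r r' k v p he h1 h2 hk
    have hmem := List.mem_of_getElem? hk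
    rcases BS_ite_cases h1 with h | ⟨ha, h⟩ | ⟨ha, h⟩
    · simp [h.1] at hk
    · have hev := he.eval (f1 _ (by simp) (g1.cpM _ _ _ _ _ h hmem).1)
      rcases BS_ite_cases h2 with h' | ⟨hb, h'⟩ | ⟨hb, h'⟩
      · right; simp [h'.1, h'.2]
      · exact g1.t3 _ _ _ _ _ _ _ _ _ (he.mono (s1 _ (by simp))) h h' hk
      · rw [hev] at ha; exact absurd hb ha
    · have hev := he.eval (f2 _ (by simp) (g2.cpM _ _ _ _ _ h hmem).1)
      rcases BS_ite_cases h2 with h' | ⟨hb, h'⟩ | ⟨hb, h'⟩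
      · right; simp [h'.1, h'.2]
      · rw [hev] at ha; exact absurd ha hb
      · exact g2.t3 _ _ _ _ _ _ _ _ _ (he.mono (s2 _ (by simp))) h h' hk

theorem star_self (H : Env) (x : TVar) : x ∈ envStar H x :=
  Set.mem_iUnion.2 ⟨0, rfl⟩

theorem star_step {H : Env} {x y : TVar} (h : y ∈ envStar H x) : H y ⊆ envStar H x := by
  obtain ⟨n, hn⟩ := Set.mem_iUnion.1 h
  intro z hz
  exact Set.mem_iUnion.2 ⟨n + 1, mem_comp hn hz⟩

/-- Induction and case principle for loop runs. -/
theorem BS_while_ind {a : Chan} {e : Expr} {c : Cmd}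
    {P : Store → List (Val × PPoint) → Option Store → Prop}
    (hpart : ∀ σ, P σ [] none)
    (hF : ∀ σ, e.eval σ = 0 → P σ [] (some σ))
    (hP : ∀ σ us, e.eval σ ≠ 0 → BS a c σ us none → P σ us none)
    (hT : ∀ σ us σ₁ us' r, e.eval σ ≠ 0 → BS a c σ us (some σ₁) → BS a (.while e c) σ₁ us' r →
      P σ₁ us' r → P σ (us ++ us') r) :
    ∀ σ us r, BS a (.while e c) σ us r → P σ us r := by
  intro σ us r h
  generalize hw : Cmd.while e c = w at h
  induction h with
  | part => exact hpart _
  | whileF _ h => cases hw; exact hF _ h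
  | whileP h h' => cases hw; exact hP _ _ h h'
  | whileT h h1 h2 _ ih => cases hw; exact hT _ _ _ _ _ h h1 h2 (ih rfl)
  | _ => cases hw

theorem good_while {a : Chan} {e : Expr} {c : Cmd} {Γ : Env} (g : Good a c Γ) :
    Good a (.while e c) (Function.update (envStar (envComp Γ (guardEnv e))) .pc {TVar.pc}) := by
  generalize hF : Function.update (envStar (envComp Γ (guardEnv e))) .pc {TVar.pc} = F
  have hpc : F .pc = {TVar.pc} := by subst hF; simp
  have s0 : ∀ x, x ≠ .pc → x ∈ F x := by
    intro x hx; subst hF; rw [Function.update_of_ne hx]; exact star_self _ _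
  have s1 : ∀ x, x ≠ .pc → ∀ y ∈ F x, Γ y ⊆ F x := by
    intro x hx; subst hF; rw [Function.update_of_ne hx]
    exact fun y hy => (guard_sub Γ e y).trans (star_step hy)
  have f1 : ∀ x, x ≠ .pc → TVar.pc ∈ Γ x → fvT e ⊆ F x := by
    intro x hx h; subst hF; rw [Function.update_of_ne hx]
    exact (guard_fv h).trans (star_step (star_self _ _))
  clear hF
  have vM : ∀ x, TVar.pc ∈ Γ (.pvar x) ∨ 
      ∀ σ us σ', BS a (.while e c) σ us (some σ') → σ' x = σ x := by
    intro x
    rcases g.varM x with h | ⟨-, h⟩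
    · exact Or.inl h
    · right
      have := BS_while_ind (a := a) (e := e) (c := c)
        (P := fun σ us r => ∀ σ', r = some σ' → σ' x = σ x)
        (by simp) (by simp) (by simp)
        (by
          intro σ us σ₁ us' r _ h1 _ ih σ' hr
          rw [ih _ hr, h _ _ _ h1])
      exact fun σ us σ' hb => this _ _ _ hb _ rfl
  have cM : TVar.pc ∈ Γ (.chan a) ∨ ∀ σ us r, BS a (.while e c) σ us r → us = [] := by
    rcases g.chanM with h | h
    · exact Or.inl h
    · right
      refine BS_while_ind (by simp) (by simp) (fun _ _ _ hb => h _ _ _ hb) ?_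
      intro σ us σ₁ us' r _ h1 _ ih
      rw [ih, h _ _ _ h1]; rfl
  have pM : ∀ σ us r, BS a (.while e c) σ us r → ∀ v p, (v, p) ∈ us →
      TVar.pc ∈ Γ (.cpoint a p) ∧ TVar.chan a ∈ Γ (.cpoint a p) := by
    refine BS_while_ind (by simp) (by simp) (fun _ _ _ hb v p hm => g.cpM _ _ _ _ _ hb hm) ?_
    intro σ us σ₁ us' r _ h1 _ ih v p hm
    rcases List.mem_append.1 hm with hm | hm
    · exact g.cpM _ _ _ _ _ h1 hm
    · exact ih _ _ hm
  have sub : ∀ x, x ≠ .pc → Γ x ⊆ F x := fun x hx => s1 x hx x (s0 x hx)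
  refine ⟨hpc, fun b => s0 _ (by simp), fun b p => s0 _ (by simp), ?_, ?_, ?_, ?_, ?_, ?_⟩
  · intro x
    rcases vM x with h | h
    · exact Or.inl (sub _ (by simp) h)
    · exact Or.inr ⟨s0 _ (by simp), h⟩
  · rcases cM with h | h
    · exact Or.inl (sub _ (by simp) h)
    · exact Or.inr h
  · intro σ us r v p h hm
    have := pM _ _ _ h _ _ hm
    exact ⟨sub _ (by simp) this.1, sub _ (by simp) this.2⟩
  · intro x σ ρ us vs σ' ρ' he h1 h2
    rcases vM x with hx | hx
    · have hfv := f1 _ (by simp) hx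
      have := BS_while_ind (a := a) (e := e) (c := c)
        (P := fun σ us r => ∀ σ' ρ vs ρ', r = some σ' → eqS (F (.pvar x)) σ ρ →
          BS a (.while e c) ρ vs (some ρ') → σ' x = ρ' x)
        (by simp)
        (by
          intro σ h0 σ' ρ vs ρ' hr he hb
          cases hr
          have hev := he.eval hfv
          cases hb with
          | whileF _ h => exact he x (s0 _ (by simp))
          | whileT h => exact absurd (hev ▸ h0) h)
        (by simp)
        (by
          intro σ us σ₁ us' r h0 a1 _ ih σ' ρ vs ρ' hr he hb
          have hev := he.eval hfv
          cases hb with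
          | whileF _ h => exact absurd (hev.trans h) h0
          | whileT h b1 b2 =>
            exact ih _ _ _ _ hr (g.t1S (s1 _ (by simp)) he a1 b1) b2)
      exact this _ _ _ h1 _ _ _ _ rfl he h2
    · rw [hx _ _ _ h1, hx _ _ _ h2]
      exact he x (s0 _ (by simp))
  · intro σ ρ us vs σ' r he h1 h2
    rcases cM with hx | hx
    · have hfv := f1 _ (by simp) hx
      have := BS_while_ind (a := a) (e := e) (c := c)
        (P := fun σ us q => ∀ σ' ρ vs r, q = some σ' → eqS (F (.chan a)) σ ρ →
          BS a (.while e c) ρ vs r → vs.length ≤ us.length)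
        (by simp)
        (by
          intro σ h0 σ' ρ vs r hr he hb
          have hev := he.eval hfv
          cases hb with
          | part => simp
          | whileF _ h => simp
          | whileP h => exact absurd (hev ▸ h0) h
          | whileT h => exact absurd (hev ▸ h0) h)
        (by simp)
        (by
          intro σ us σ₁ us' q h0 a1 _ ih σ' ρ vs r hr he hb
          have hev := he.eval hfv
          have hc := he.mono (sub _ (by simp))
          cases hb with
          | part => simp
          | whileF _ h => exact absurd (hev.trans h) h0
          | whileP h b1 =>
            have := g.t2 _ _ _ _ _ _ hc a1 b1
            simp; omega
          | whileT h b1 b2 =>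
            have e1 := g.t2 _ _ _ _ _ _ hc a1 b1
            have e2 := ih _ _ _ _ hr (g.t1S (s1 _ (by simp)) he a1 b1) b2
            simp; omega)
      exact this _ _ _ h1 _ _ _ _ rfl he h2
    · simp [hx _ _ _ h2]
  · intro σ ρ us vs r r' k v p he h1 h2 hk
    have hm := pM _ _ _ h1 _ _ (List.mem_of_getElem? hk)
    have hfv := f1 _ (by simp) hm.1
    have hchan : Γ (.chan a) ⊆ F (.cpoint a p) :=
      s1 _ (by simp) _ (sub _ (by simp) hm.2)
    have key : ∀ σ ρ us vs r r' k, eqS (F (.cpoint a p)) σ ρ → e.eval σ ≠ 0 → BS a c σ us r →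
        BS a (.while e c) ρ vs r' → us[k]? = some (v, p) →
        vs[k]? = some (v, p) ∨ (vs.length ≤ k ∧ r' = none) := by
      intro σ ρ us vs r r' k he h0 ha hb hk
      have hev := he.eval hfv
      have hc := he.mono (sub _ (by simp))
      cases hb with
      | part => simp
      | whileF _ h => exact absurd (hev.trans h) h0
      | whileP h b1 => exact g.t3 _ _ _ _ _ _ _ _ _ hc ha b1 hk
      | whileT h b1 b2 => exact Or.inl (g.t3_app hc ha b1 hk)
    have := BS_while_ind (a := a) (e := e) (c := c)
      (P := fun σ us r => ∀ ρ vs r' k, eqS (F (.cpoint a p)) σ ρ →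
        BS a (.while e c) ρ vs r' → us[k]? = some (v, p) →
        vs[k]? = some (v, p) ∨ (vs.length ≤ k ∧ r' = none))
      (by simp) (by simp)
      (fun σ us h0 ha ρ vs r' k he hb hk => key _ _ _ _ _ _ _ he h0 ha hb hk)
      (by
        intro σ us σ₁ us' q h0 a1 _ ih ρ vs r' k he hb hk
        by_cases hlt : k < us.length
        · rw [List.getElem?_append_left hlt] at hk
          exact key _ _ _ _ _ _ _ he h0 a1 hb hk
        · push Not at hlt
          rw [List.getElem?_append_right hlt] at hk
          have hev := he.eval hfv
          have hch := he.mono hchan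
          cases hb with
          | part => simp
          | whileF _ h => exact absurd (hev.trans h) h0
          | whileP h b1 =>
            have := g.t2 _ _ _ _ _ _ hch a1 b1
            exact Or.inr ⟨by omega, rfl⟩
          | whileT h b1 b2 =>
            have hl := g.t2E hch a1 b1
            have := ih _ _ _ _ (g.t1S (s1 _ (by simp)) he a1 b1) b2 hk
            rw [List.getElem?_append_right (by omega), List.length_append, ← hl]
            rcases this with h | h
            · exact Or.inl h
            · exact Or.inr ⟨by omega, h.2⟩)
    exact this _ _ _ h1 _ _ _ _ he h2 hk

theorem good_of_typing {a : Chan} {c : Cmd} {Γ : Env} (h : Typing c Γ) : Good a c Γ := by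
  induction h with
  | skip => exact good_skip a
  | assign x e => exact good_assign a x e
  | seq _ _ ih1 ih2 => exact good_seq ih1 ih2
  | ite _ _ ih1 ih2 => exact good_ite ih1 ih2
  | whileT _ ih => exact good_while ih
  | out e b p => exact good_out a e b p

theorem omega_run {S : Type} (A : Attacker S) (t : List Val) :
    A.omega.run t = (A.run t, t.length) := by
  have : ∀ s n, t.foldl A.omega.step (s, n) = (t.foldl A.step s, n + t.length) := by
    induction t with
    | nil => simp
    | cons v t ih =>
      intro s n
      simp only [List.foldl_cons, List.length_cons]
      have : A.omega.step (s, n) v = (A.step s v, n + 1) := rfl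
      rw [this, ih]
      simp; omega
  have h := this A.init 0
  simpa [Attacker.run, Attacker.omega] using h

/-- PI dynamic policy compliance against all forgetful attackers. -/
theorem typing_PISecure_compliance {c : Cmd} {A : PolApprox} {D : DynPolicy} {Γ : Env}
    (hsound : SoundApprox c A D) (hty : Typing c Γ)
    (hcoarse : ∀ (a : Chan) (p : PPoint) (ρ₁ ρ₂ : Store),
      A.rel a p ρ₁ ρ₂ → eqG Γ (.cpoint a p) ρ₁ ρ₂) :
    ∀ (S : Type) (Att : Attacker S) (a : Chan) (σ : Store), PISecure c D Att a σ := by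
  intro S Att a σ t n c' σ' v ⟨ls, hls, hlst⟩ ⟨cfg', ls1, h1, hv⟩ ρ ⟨hek, hsharp⟩ hD
  have hk : ρ ∈ kSharp Att c a t := not_not.1 hsharp
  obtain ⟨t', v', hprod, hrun⟩ := hk
  apply hek
  refine ⟨t' ++ [v'], hprod, ?_⟩
  rw [omega_run, omega_run, Prod.mk.injEq] at hrun
  obtain ⟨m, cfg₂, ls2, h2, hp2⟩ := hprod
  suffices hvv : v' = v by
    subst hvv
    have := hrun.1
    simp only [Attacker.run] at this
    simp [Attacker.run, List.foldl_append, this]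
  cases h1 with
  | step hs hrest =>
  rename_i α cfgm lsm
  cases hrest
  cases α with
  | silent => simp [Label.consTo, projA] at hv
  | out b w p =>
  by_cases hb : b = a
  · subst hb
    simp [Label.consTo, projA] at hv
    subst hv
    have heq := hcoarse b p _ _ (hsound σ n ls c' σ' b w p _ hls hs ρ σ hD)
    have bs1 : BS b c σ (projP b ls ++ [(w, p)]) none := by
      have := BS_steps (a := b) hls _ _ (BS_step (a := b) hs [] none (BS.part _ _))
      simpa [projP] using this
    have bs2 : BS b c ρ (projP b ls2) none := by
      simpa using BS_steps (a := b) h2 [] none (BS.part _ _)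
    have len1 : (projP b ls).length = t.length := by
      rw [← hlst, ← projP_fst, List.length_map]
    have g : Good b c Γ := good_of_typing hty
    have heq' : eqS (Γ (.cpoint b p)) σ ρ := eqS.symm heq
    have hmap : (projP b ls2).map Prod.fst = t' ++ [v'] := by rw [projP_fst, hp2]
    have hlen : (projP b ls2).length = t'.length + 1 := by
      have := congrArg List.length hmap
      simpa using this
    rcases g.t3 _ _ _ _ _ _ t.length w p heq' bs1 bs2 (by simp [← len1]) with h | h
    · have h3 : ((projP b ls2).map Prod.fst)[t.length]? = some w := by
        rw [List.getElem?_map, h]; rfl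
      rw [hmap, ← hrun.2] at h3
      simpa using h3
    · have := hrun.2
      omega
  · simp [Label.consTo, projA, hb] at hv
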